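/- Consider a VC-SNDP instance with graph G, terminal set R, and demands d_{s,t}, and let H be a minimal feasible solution with at most ℓ edges. Then every vertex of H lies at shortest-path distance at most ℓ in G from some terminal of R. -/

import Mathlib

open SimpleGraph

/-- A family of `n` distinct pairwise internally vertex-disjoint `s`-`t` paths:
any two of them only share the vertices `s` and `t`. -/
def IntDisjPaths {V : Type*} (G : SimpleGraph V) (s t : V) (n : ℕ)
    (P : Fin n → G.Walk s t) : Prop :=
  (∀ i, (P i).IsPath) ∧ ∀ i j, i ≠ j → P i ≠ P j ∧
    ∀ v, v ∈ (P i).support → v ∈ (P j).support → v = s ∨ v = t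

/-- The vertex-connectivity `κ_G(s,t)`: the maximum number of pairwise
internally vertex-disjoint `s`-`t` paths. -/
noncomputable def vConn {V : Type*} (G : SimpleGraph V) (s t : V) : ℕ :=
  sSup {n | ∃ P : Fin n → G.Walk s t, IntDisjPaths G s t n P}

/-- Feasibility for VC-SNDP: the subgraph `H` satisfies all vertex-connectivity
demands between distinct terminal pairs. -/
def VCFeasible {V : Type*} (H : SimpleGraph V) (R : Set V) (d : V → V → ℕ) : Prop :=
  ∀ s ∈ R, ∀ t ∈ R, s ≠ t → d s t ≤ vConn H s t

theorem IntDisjPaths.le_card {V : Type*} [Fintype V] {G : SimpleGraph V} {s t : V} {n : ℕ}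
    {P : Fin n → G.Walk s t} (h : IntDisjPaths G s t n P) : n ≤ Nat.card (G.Path s t) := by
  classical
  have hinj : Function.Injective fun i => (⟨P i, h.1 i⟩ : G.Path s t) := by
    intro i j hij
    by_contra hne
    exact (h.2 i j hne).1 (congrArg Subtype.val hij)
  simpa using Nat.card_le_card_of_injective _ hinj

theorem bddAbove_intDisjPaths {V : Type*} [Fintype V] (G : SimpleGraph V) (s t : V) :
    BddAbove {n | ∃ P : Fin n → G.Walk s t, IntDisjPaths G s t n P} :=
  ⟨Nat.card (G.Path s t), fun _ ⟨_, hP⟩ => hP.le_card⟩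

theorem IntDisjPaths.le_vConn {V : Type*} [Fintype V] {G : SimpleGraph V} {s t : V} {n : ℕ}
    {P : Fin n → G.Walk s t} (h : IntDisjPaths G s t n P) : n ≤ vConn G s t :=
  le_csSup (bddAbove_intDisjPaths G s t) ⟨P, h⟩

theorem exists_intDisjPaths_vConn {V : Type*} [Fintype V] (G : SimpleGraph V) (s t : V) :
    ∃ P : Fin (vConn G s t) → G.Walk s t, IntDisjPaths G s t (vConn G s t) P :=
  Nat.sSup_mem (s := {n | ∃ P : Fin n → G.Walk s t, IntDisjPaths G s t n P})
    ⟨0, fun i => i.elim0, fun i => i.elim0, fun i => i.elim0⟩ (bddAbove_intDisjPaths G s t)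

/-- A family of internally disjoint paths avoiding an edge survives the deletion of that edge. -/
theorem IntDisjPaths.le_vConn_deleteEdges {V : Type*} [Fintype V] {G : SimpleGraph V} {s t : V}
    {n : ℕ} {P : Fin n → G.Walk s t} (h : IntDisjPaths G s t n P) {e : Sym2 V}
    (he : ∀ i, e ∉ (P i).edges) : n ≤ vConn (G.deleteEdges {e}) s t := by
  refine IntDisjPaths.le_vConn (P := fun i => (P i).toDeleteEdge e (he i)) ⟨fun i => ?_, ?_⟩
  · exact (h.1 i).transfer _
  · intro i j hij
    refine ⟨fun heq => (h.2 i j hij).1 (Walk.ext_support ?_), fun v hi hj => (h.2 i j hij).2 v ?_ ?_⟩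
    · simpa [Walk.support_transfer] using congrArg Walk.support heq
    · simpa [Walk.support_transfer] using hi
    · simpa [Walk.support_transfer] using hj

theorem SimpleGraph.Walk.IsPath.length_le_ncard_edgeSet {V : Type*} [Finite V]
    {G : SimpleGraph V} {s t : V} {p : G.Walk s t} (hp : p.IsPath) :
    p.length ≤ G.edgeSet.ncard := by
  classical
  rw [← p.length_edges, ← List.toFinset_card_of_nodup hp.isTrail.edges_nodup,
    ← Set.ncard_coe_finset]
  refine Set.ncard_le_ncard (fun e he => p.edges_subset_edgeSet ?_) (Set.toFinite _)
  simpa using he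

/-- Every vertex of a minimal feasible VC-SNDP solution `H` with at most `ℓ`
edges lies at shortest-path distance at most `ℓ` in `G` from some terminal. -/
theorem vc_minimal_solution_near_terminals {V : Type*} [Fintype V] [DecidableEq V]
    (G H : SimpleGraph V) (R : Set V) (d : V → V → ℕ) (ℓ : ℕ)
    (hHG : H ≤ G)
    (hfeas : VCFeasible H R d)
    (hmin : ∀ e ∈ H.edgeSet, ¬ VCFeasible (H.deleteEdges {e}) R d)
    (hsize : H.edgeSet.ncard ≤ ℓ) :
    ∀ v ∈ H.support, ∃ r ∈ R, G.dist r v ≤ ℓ := by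
  rintro v ⟨w, hvw⟩
  have hdel := hmin s(v, w) hvw
  simp only [VCFeasible, not_forall, not_le] at hdel
  obtain ⟨s, hs, t, ht, hst, hlt⟩ := hdel
  obtain ⟨P, hP⟩ := exists_intDisjPaths_vConn H s t
  obtain ⟨i, hi⟩ : ∃ i, s(v, w) ∈ (P i).edges := by
    by_contra! h
    exact absurd (hP.le_vConn_deleteEdges h) (hlt.trans_le (hfeas s hs t ht hst)).not_ge
  have hv : v ∈ (P i).support := (P i).fst_mem_support_of_mem_edges hi
  refine ⟨s, hs, ?_⟩
  calc G.dist s v ≤ (((P i).takeUntil v hv).mapLe hHG).length := dist_le _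
    _ = ((P i).takeUntil v hv).length := Walk.length_map _ _
    _ ≤ H.edgeSet.ncard := ((hP.1 i).takeUntil hv).length_le_ncard_edgeSet
    _ ≤ ℓ := hsize
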